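/- arXiv:1202.2033 — 6 statements merged into one kernel-verified Lean document; each statement's English description precedes it below -/
import Mathlib

section
/- Let n ≥ 1 and let 0 = t₀ < t₁ < t₂ < … < tₙ be real numbers. Define the real symmetric n×n matrix M by M_{kk} = 1/(t_k − t_{k−1}) + 1/(t_{k+1} − t_k) for 1 ≤ k ≤ n−1, M_{nn} = 1/(tₙ − t_{n−1}), M_{k,k+1} = M_{k+1,k} = −1/(t_{k+1} − t_k) for 1 ≤ k ≤ n−1, and M_{jk} = 0 whenever |j − k| ≥ 2. Then M is invertible and its inverse K is given by K_{jk} = min(t_j, t_k); in particular M is positive definite. -/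
open Matrix

/-- The backward difference matrix `(B x) i = x i - x (i - 1)`, with `x (-1) = 0`. -/
def backwardDiff (n : ℕ) : Matrix (Fin n) (Fin n) ℝ :=
  Matrix.of fun i j => (if (i : ℕ) = j then 1 else 0) - (if (i : ℕ) = j + 1 then 1 else 0)

/-- The partial sum matrix `(S x) i = x 0 + ⋯ + x i`. -/
def partialSum (n : ℕ) : Matrix (Fin n) (Fin n) ℝ :=
  Matrix.of fun i j => if (j : ℕ) ≤ i then 1 else 0

theorem partialSum_mul_backwardDiff (n : ℕ) : partialSum n * backwardDiff n = 1 := by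
  ext ⟨j, hj⟩ ⟨k, hk⟩
  simp only [Matrix.mul_apply, partialSum, backwardDiff, Matrix.of_apply, Matrix.one_apply,
    Fin.mk.injEq]
  rw [Fin.sum_univ_eq_sum_range (fun i => (if i ≤ j then (1 : ℝ) else 0) *
    ((if i = k then 1 else 0) - (if i = k + 1 then 1 else 0)))]
  simp only [mul_sub, Finset.sum_sub_distrib, mul_ite, mul_one, mul_zero, Finset.sum_ite_eq',
    Finset.mem_range]
  split_ifs <;> first | omega | norm_num

theorem backwardDiff_mul_partialSum (n : ℕ) : backwardDiff n * partialSum n = 1 :=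
  mul_eq_one_comm.mp (partialSum_mul_backwardDiff n)

theorem backwardDiff_transpose_mul_diagonal_mul_apply (n : ℕ) (d : ℕ → ℝ) (j k : Fin n) :
    ((backwardDiff n)ᵀ * diagonal (fun i : Fin n => d i) * backwardDiff n) j k =
      if (j : ℕ) = k then d j + (if (j : ℕ) + 1 < n then d (j + 1) else 0)
      else if (j : ℕ) + 1 = k then -d k else if (k : ℕ) + 1 = j then -d j else 0 := by
  obtain ⟨j, hj⟩ := j
  obtain ⟨k, hk⟩ := k
  rw [Matrix.mul_apply]
  simp only [Matrix.mul_diagonal, backwardDiff, Matrix.of_apply,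
    Matrix.transpose_apply]
  rw [Fin.sum_univ_eq_sum_range (fun i => ((if i = j then (1 : ℝ) else 0) -
    (if i = j + 1 then 1 else 0)) * d i * ((if i = k then 1 else 0) - (if i = k + 1 then 1 else 0)))]
  simp only [mul_sub, Finset.sum_sub_distrib, mul_ite, mul_one, mul_zero, Finset.sum_ite_eq',
    Finset.mem_range]
  split_ifs <;> first | omega | (subst_vars; simp)

theorem partialSum_mul_diagonal_mul_transpose_apply (n : ℕ) (t : ℕ → ℝ) (j k : Fin n) :
    (partialSum n * diagonal (fun i : Fin n => t (i + 1) - t i) * (partialSum n)ᵀ) j k =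
      t (min (j : ℕ) k + 1) - t 0 := by
  obtain ⟨j, hj⟩ := j
  obtain ⟨k, hk⟩ := k
  rw [Matrix.mul_apply]
  simp only [Matrix.mul_diagonal, partialSum, Matrix.of_apply,
    Matrix.transpose_apply]
  rw [Fin.sum_univ_eq_sum_range (fun i => (if i ≤ j then (1 : ℝ) else 0) * (t (i + 1) - t i) *
    (if i ≤ k then 1 else 0)), ← Finset.sum_range_sub]
  symm
  refine (Finset.sum_congr rfl fun i hi => ?_).trans
    (Finset.sum_subset (Finset.range_subset_range.mpr (by omega)) fun i _ hi => ?_)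
  · rw [Finset.mem_range] at hi
    simp [show i ≤ j by omega, show i ≤ k by omega]
  · rw [Finset.mem_range] at hi
    split_ifs <;> first | omega | simp

/-- Let `n ≥ 1` and `0 = t₀ < t₁ < … < tₙ`. The tridiagonal matrix `M` of
the discretized kinetic action with mixed boundary conditions (index `k : Fin n`
corresponding to the index `k+1 ∈ {1,…,n}` of the paper), namely
`M_{kk} = 1/(t_k−t_{k−1}) + 1/(t_{k+1}−t_k)` for `k ≤ n−1`, `M_{nn} = 1/(tₙ−t_{n−1})`,
`M_{k,k+1} = M_{k+1,k} = −1/(t_{k+1}−t_k)`, `M_{jk} = 0` for `|j−k| ≥ 2`,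
is invertible with inverse `K_{jk} = min(t_j, t_k)`; in particular `M` is positive
definite. -/
theorem kinetic_matrix_MBC_inverse_and_posdef (n : ℕ) (hn : 1 ≤ n)
    (t : ℕ → ℝ) (ht0 : t 0 = 0) (hmono : ∀ k, k < n → t k < t (k + 1))
    (M : Matrix (Fin n) (Fin n) ℝ)
    (hdiag : ∀ k : Fin n, (k : ℕ) + 1 < n →
      M k k = 1 / (t ((k : ℕ) + 1) - t (k : ℕ)) + 1 / (t ((k : ℕ) + 2) - t ((k : ℕ) + 1)))
    (hlast : ∀ k : Fin n, (k : ℕ) + 1 = n →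
      M k k = 1 / (t ((k : ℕ) + 1) - t (k : ℕ)))
    (hoff : ∀ j k : Fin n, (j : ℕ) + 1 = (k : ℕ) →
      M j k = -(1 / (t ((j : ℕ) + 2) - t ((j : ℕ) + 1))) ∧
      M k j = -(1 / (t ((j : ℕ) + 2) - t ((j : ℕ) + 1))))
    (hzero : ∀ j k : Fin n, (j : ℕ) + 2 ≤ (k : ℕ) ∨ (k : ℕ) + 2 ≤ (j : ℕ) → M j k = 0)
    (K : Matrix (Fin n) (Fin n) ℝ)
    (hK : ∀ j k : Fin n, K j k = min (t ((j : ℕ) + 1)) (t ((k : ℕ) + 1))) :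
    M * K = 1 ∧ K * M = 1 ∧ M.PosDef := by
  have hd : ∀ k : Fin n, 0 < t ((k : ℕ) + 1) - t k := fun k => sub_pos.mpr (hmono k k.2)
  have ht : ∀ a b, a ≤ b → b ≤ n → t a ≤ t b := fun a b hab => by
    induction b, hab using Nat.le_induction with
    | base => exact fun _ => le_rfl
    | succ b _ ih => exact fun hb => (ih (by omega)).trans (hmono b hb).le
  have hM : M = (backwardDiff n)ᵀ *
      diagonal (fun i : Fin n => 1 / (t ((i : ℕ) + 1) - t i)) * backwardDiff n := by
    ext j k
    rw [backwardDiff_transpose_mul_diagonal_mul_apply n (fun i => 1 / (t (i + 1) - t i))]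
    split_ifs with h h₁ h₂ h₃
    · rw [← Fin.ext h, hdiag j h₁]
    · rw [← Fin.ext h, hlast j (by omega), add_zero]
    · rw [(hoff j k h₂).1, ← h₂]
    · rw [(hoff k j h₃).2, ← h₃]
    · exact hzero j k (by omega)
  have hK' : K = partialSum n * diagonal (fun i : Fin n => t ((i : ℕ) + 1) - t i) *
      (partialSum n)ᵀ := by
    ext j k
    rw [hK, partialSum_mul_diagonal_mul_transpose_apply, ht0, sub_zero]
    rcases le_total (j : ℕ) k with h | h
    · rw [min_eq_left h, min_eq_left (ht _ _ (by omega) (by omega))]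
    · rw [min_eq_right h, min_eq_right (ht _ _ (by omega) (by omega))]
  have hD : diagonal (fun i : Fin n => 1 / (t ((i : ℕ) + 1) - t i)) *
      diagonal (fun i : Fin n => t ((i : ℕ) + 1) - t i) = 1 := by
    rw [diagonal_mul_diagonal, ← diagonal_one]
    congr 1
    ext i
    exact one_div_mul_cancel (hd i).ne'
  have hMK : M * K = 1 := by
    rw [hM, hK']
    simp only [Matrix.mul_assoc]
    rw [← Matrix.mul_assoc (backwardDiff n), backwardDiff_mul_partialSum, Matrix.one_mul,
      ← Matrix.mul_assoc (diagonal _) (diagonal _), hD, Matrix.one_mul,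
      ← Matrix.transpose_mul, partialSum_mul_backwardDiff, Matrix.transpose_one]
  refine ⟨hMK, mul_eq_one_comm.mp hMK, ?_⟩
  rw [hM, ← conjTranspose_eq_transpose_of_trivial]
  refine (PosDef.diagonal fun i => one_div_pos.mpr (hd i)).conjTranspose_mul_mul_same ?_
  exact mulVec_injective_of_isUnit
    (IsUnit.of_mul_eq_one _ (backwardDiff_mul_partialSum n))
end

section
/- Let n ≥ 1 and let 0 = t₀ < t₁ < … < tₙ < t_{n+1} = T be real numbers. Define the real symmetric n×n matrix M by M_{kk} = 1/(t_k − t_{k−1}) + 1/(t_{k+1} − t_k) for 1 ≤ k ≤ n, M_{k,k+1} = M_{k+1,k} = −1/(t_{k+1} − t_k) for 1 ≤ k ≤ n−1, and M_{jk} = 0 whenever |j − k| ≥ 2. Then M is invertible and its inverse K^{(T)} is given by K^{(T)}_{jk} = min(t_j, t_k)·(1 − max(t_j, t_k)/T); in particular M is positive definite. -/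
open Matrix

/-- The backward difference matrix on `n` interior nodes with Dirichlet boundary conditions: on
the vector `(f 1, …, f n)` its `e`-th output is `f (e + 1) - f e`, where `f 0 = f (n + 1) = 0`. -/
def dirichletDiff (n : ℕ) : Matrix (Fin (n + 1)) (Fin n) ℝ :=
  Matrix.of fun e j => (if e = j.castSucc then 1 else 0) - (if e = j.succ then 1 else 0)

theorem dirichletDiff_mulVec {n : ℕ} (f : ℕ → ℝ) (h₀ : f 0 = 0) (h₁ : f (n + 1) = 0)
    (e : Fin (n + 1)) :
    (dirichletDiff n *ᵥ fun j => f (j + 1)) e = f (e + 1) - f e := by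
  simp only [mulVec, dotProduct, dirichletDiff, of_apply, sub_mul, ite_mul, one_mul, zero_mul,
    Finset.sum_sub_distrib]
  congr 1
  · refine Fin.lastCases ?_ (fun i => ?_) e
    · simp [h₁, (Fin.castSucc_ne_last _).symm]
    · simp
  · refine Fin.cases ?_ (fun i => ?_) e
    · simp [h₀, (Fin.succ_ne_zero _).symm]
    · simp

theorem dirichletDiff_transpose_mulVec {n : ℕ} (g : Fin (n + 1) → ℝ) (i : Fin n) :
    ((dirichletDiff n)ᵀ *ᵥ g) i = g i.castSucc - g i.succ := by
  simp [mulVec, dotProduct, dirichletDiff, sub_mul]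

/-- A tridiagonal matrix whose entries are those of the weighted path Laplacian with Dirichlet
boundary conditions factors through the difference matrix. -/
theorem eq_dirichletDiff_transpose_mul_diagonal_mul {n : ℕ} (w : ℕ → ℝ)
    (M : Matrix (Fin n) (Fin n) ℝ)
    (hdiag : ∀ k : Fin n, M k k = w k + w (k + 1))
    (hoff : ∀ j k : Fin n, (j : ℕ) + 1 = k → M j k = -w (j + 1) ∧ M k j = -w (j + 1))
    (hzero : ∀ j k : Fin n, (j : ℕ) + 2 ≤ k ∨ (k : ℕ) + 2 ≤ j → M j k = 0) :
    M = (dirichletDiff n)ᵀ * (diagonal (fun e : Fin (n + 1) => w e) * dirichletDiff n) := by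
  ext i k
  change _ = ((dirichletDiff n)ᵀ *ᵥ fun e => (diagonal (fun e : Fin (n + 1) => w e) * dirichletDiff n) e k) i
  rw [dirichletDiff_transpose_mulVec]
  simp only [diagonal_mul, dirichletDiff, of_apply, Fin.ext_iff, Fin.val_castSucc, Fin.val_succ]
  rcases lt_trichotomy (i : ℕ) k with h | h | h
  · rcases (Nat.succ_le_of_lt h).eq_or_lt with h' | h'
    · rw [(hoff i k h').1]
      grind
    · rw [hzero i k (.inl h')]
      grind
  · obtain rfl := Fin.ext h
    rw [hdiag]
    grind
  · rcases (Nat.succ_le_of_lt h).eq_or_lt with h' | h'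
    · rw [(hoff k i h').2]
      grind
    · rw [hzero i k (.inr h')]
      grind

/-- Let `n ≥ 1` and `0 = t₀ < t₁ < … < tₙ < t_{n+1} = T`. The tridiagonal
matrix `M` of the discretized kinetic action with Dirichlet boundary conditions (index
`k : Fin n` corresponding to the index `k+1 ∈ {1,…,n}` of the paper), namely
`M_{kk} = 1/(t_k−t_{k−1}) + 1/(t_{k+1}−t_k)`, `M_{k,k+1} = M_{k+1,k} = −1/(t_{k+1}−t_k)`,
`M_{jk} = 0` for `|j−k| ≥ 2`, is invertible with inverse
`K^{(T)}_{jk} = min(t_j,t_k)·(1 − max(t_j,t_k)/T)`; in particular `M` is positive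
definite. -/
theorem kinetic_matrix_DBC_inverse_and_posdef (n : ℕ) (hn : 1 ≤ n)
    (t : ℕ → ℝ) (T : ℝ) (ht0 : t 0 = 0) (hT : t (n + 1) = T)
    (hmono : ∀ k, k < n + 1 → t k < t (k + 1))
    (M : Matrix (Fin n) (Fin n) ℝ)
    (hdiag : ∀ k : Fin n,
      M k k = 1 / (t ((k : ℕ) + 1) - t (k : ℕ)) + 1 / (t ((k : ℕ) + 2) - t ((k : ℕ) + 1)))
    (hoff : ∀ j k : Fin n, (j : ℕ) + 1 = (k : ℕ) →
      M j k = -(1 / (t ((j : ℕ) + 2) - t ((j : ℕ) + 1))) ∧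
      M k j = -(1 / (t ((j : ℕ) + 2) - t ((j : ℕ) + 1))))
    (hzero : ∀ j k : Fin n, (j : ℕ) + 2 ≤ (k : ℕ) ∨ (k : ℕ) + 2 ≤ (j : ℕ) → M j k = 0)
    (K : Matrix (Fin n) (Fin n) ℝ)
    (hK : ∀ j k : Fin n, K j k =
      min (t ((j : ℕ) + 1)) (t ((k : ℕ) + 1)) *
        (1 - max (t ((j : ℕ) + 1)) (t ((k : ℕ) + 1)) / T)) :
    M * K = 1 ∧ K * M = 1 ∧ M.PosDef := by
  have hle : ∀ i j, i ≤ j → j ≤ n + 1 → t i ≤ t j := by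
    intro i j hij
    induction j, hij using Nat.le_induction with
    | base => exact fun _ => le_rfl
    | succ j _ ih => exact fun hj => (ih (by omega)).trans (hmono j (by omega)).le
  have hTpos : 0 < T := by
    have := hle 1 (n + 1) (by omega) le_rfl
    have := hmono 0 (by omega)
    simp only [zero_add] at this
    linarith
  have hM := eq_dirichletDiff_transpose_mul_diagonal_mul (fun k => 1 / (t (k + 1) - t k)) M
    hdiag hoff hzero
  have hMK : M * K = 1 := by
    ext i l
    set f : ℕ → ℝ := fun m => min (t m) (t (l + 1)) * (1 - max (t m) (t (l + 1)) / T) with hf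
    have hlow : ∀ m ≤ (l : ℕ) + 1, f m = t m * (1 - t (l + 1) / T) := fun m hm => by
      have := hle m (l + 1) hm (by omega)
      simp only [hf, min_eq_left this, max_eq_right this]
    have hhigh : ∀ m, (l : ℕ) + 1 ≤ m → m ≤ n + 1 → f m = t (l + 1) * (1 - t m / T) :=
      fun m hm hm' => by
        have := hle (l + 1) m hm hm'
        simp only [hf, min_eq_right this, max_eq_left this]
    have hf₀ : f 0 = 0 := by rw [hlow 0 (by omega), ht0, zero_mul]
    have hf₁ : f (n + 1) = 0 := by
      rw [hhigh (n + 1) (by omega) le_rfl, hT, div_self hTpos.ne', sub_self, mul_zero]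
    have hcol : (fun j => K j l) = fun j : Fin n => f (j + 1) := funext fun j => hK j l
    change (M *ᵥ fun j => K j l) i = _
    rw [hcol, hM, ← mulVec_mulVec, dirichletDiff_transpose_mulVec, ← mulVec_mulVec,
      mulVec_diagonal, mulVec_diagonal, dirichletDiff_mulVec f hf₀ hf₁,
      dirichletDiff_mulVec f hf₀ hf₁]
    simp only [Fin.val_castSucc, Fin.val_succ, one_apply, Fin.ext_iff]
    have hi := i.isLt
    have hd₀ : t (i + 1) - t i ≠ 0 := (sub_pos.2 (hmono i (by omega))).ne'
    have hd₁ : t (i + 1 + 1) - t (i + 1) ≠ 0 := (sub_pos.2 (hmono (i + 1) (by omega))).ne'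
    rcases lt_trichotomy (i : ℕ) l with h | h | h
    · rw [hlow i (by omega), hlow (i + 1) (by omega), hlow (i + 1 + 1) (by omega), if_neg h.ne]
      field_simp
      ring
    · rw [hlow i (by omega), hlow (i + 1) (by omega), hhigh (i + 1 + 1) (by omega) (by omega),
        if_pos h, ← h]
      field_simp
      ring
    · rw [hhigh i (by omega) (by omega), hhigh (i + 1) (by omega) (by omega),
        hhigh (i + 1 + 1) (by omega) (by omega), if_neg h.ne']
      field_simp
      ring
  have hKM : K * M = 1 := mul_eq_one_comm.1 hMK
  refine ⟨hMK, hKM, ?_⟩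
  have hw : (diagonal fun e : Fin (n + 1) => 1 / (t (e + 1) - t e)).PosSemidef :=
    PosSemidef.diagonal fun e => one_div_nonneg.2 (sub_pos.2 (hmono e e.isLt)).le
  have hpsd : M.PosSemidef := by
    rw [hM, ← Matrix.mul_assoc, ← conjTranspose_eq_transpose_of_trivial]
    exact hw.conjTranspose_mul_mul_same _
  exact hpsd.posDef_iff_isUnit.2 (IsUnit.of_mul_eq_one K hMK)
end

section
/- For every α > 0 and every x ∈ ℝ, setting β = 2α², one has (1/(2α))·e^{−|x|/α} = ∫₀^∞ (1/β)·e^{−s/β} · e^{−x²/(2s)}/√(2πs) ds, the integral being absolutely convergent. -/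
open MeasureTheory Real Set

open Filter Topology

/-- The primitive, vanishing at `0`, of the unnormalised Gaussian `v ↦ exp (-v² / 2)`. -/
noncomputable def gaussianPrimitive (t : ℝ) : ℝ :=
  ∫ v in (0 : ℝ)..t, Real.exp (-(1 / 2) * v ^ 2)

lemma gaussianPrimitive_zero : gaussianPrimitive 0 = 0 :=
  intervalIntegral.integral_same

lemma hasDerivAt_gaussianPrimitive (t : ℝ) :
    HasDerivAt gaussianPrimitive (Real.exp (-(1 / 2) * t ^ 2)) t := by
  have hc : Continuous fun v : ℝ => Real.exp (-(1 / 2) * v ^ 2) := by fun_prop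
  exact intervalIntegral.integral_hasDerivAt_right (hc.intervalIntegrable _ _)
    (hc.stronglyMeasurableAtFilter _ _) hc.continuousAt

lemma gaussianPrimitive_neg (t : ℝ) : gaussianPrimitive (-t) = -gaussianPrimitive t := by
  have h := intervalIntegral.integral_comp_neg (a := 0) (b := t)
    fun v : ℝ => Real.exp (-(1 / 2) * v ^ 2)
  simp only [neg_sq, neg_zero] at h
  rw [gaussianPrimitive, gaussianPrimitive, h, intervalIntegral.integral_symm]

lemma tendsto_gaussianPrimitive_atTop :
    Tendsto gaussianPrimitive atTop (𝓝 (√(2 * π) / 2)) := by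
  have h := intervalIntegral_tendsto_integral_Ioi (0 : ℝ)
    (integrable_exp_neg_mul_sq (b := 1 / 2) (by norm_num)).integrableOn tendsto_id
  rw [integral_gaussian_Ioi, show π / (1 / 2) = 2 * π by ring] at h
  exact h

lemma tendsto_gaussianPrimitive_atBot :
    Tendsto gaussianPrimitive atBot (𝓝 (-(√(2 * π) / 2))) := by
  have h := (tendsto_gaussianPrimitive_atTop.comp tendsto_neg_atBot_atTop).neg
  refine h.congr fun t => ?_
  simp [gaussianPrimitive_neg]

/-- The fundamental theorem of calculus on `(a, ∞)` for a nonnegative derivative, when the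
primitive has limits at `a⁺` and at `∞`. -/
lemma integrableOn_and_integral_Ioi_of_hasDerivAt_of_nonneg_of_tendsto
    {g g' : ℝ → ℝ} {a l m : ℝ}
    (hderiv : ∀ x ∈ Ioi a, HasDerivAt g (g' x) x) (hpos : ∀ x ∈ Ioi a, 0 ≤ g' x)
    (ha : Tendsto g (𝓝[>] a) (𝓝 l)) (htop : Tendsto g atTop (𝓝 m)) :
    IntegrableOn g' (Ioi a) ∧ ∫ x in Ioi a, g' x = m - l := by
  have hcont : ContinuousWithinAt (Function.update g a l) (Ici a) a := by
    rw [continuousWithinAt_update_same, Ici_sdiff_left]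
    exact ha
  have hderiv' : ∀ x ∈ Ioi a, HasDerivAt (Function.update g a l) (g' x) x := by
    intro x hx
    refine (hderiv x hx).congr_of_eventuallyEq ?_
    filter_upwards [Ioi_mem_nhds hx] with y hy
    exact Function.update_of_ne (ne_of_gt hy) _ _
  have htop' : Tendsto (Function.update g a l) atTop (𝓝 m) := by
    refine htop.congr' ?_
    filter_upwards [eventually_gt_atTop a] with y hy
    exact (Function.update_of_ne (ne_of_gt hy) _ _).symm
  refine ⟨integrableOn_Ioi_deriv_of_nonneg hcont hderiv' hpos htop', ?_⟩
  rw [integral_Ioi_of_hasDerivAt_of_nonneg hcont hderiv' hpos htop', Function.update_self]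

/-- A primitive, up to a constant factor, of `s ↦ exp (-s / (2α²) - c² / (2s)) / √s`. -/
noncomputable def laplaceMixturePrimitive (α c s : ℝ) : ℝ :=
  Real.exp (-c / α) * gaussianPrimitive (√s / α - c / √s) +
    Real.exp (c / α) * gaussianPrimitive (√s / α + c / √s)

lemma hasDerivAt_laplaceMixturePrimitive {α : ℝ} (hα : 0 < α) (c : ℝ) {s : ℝ} (hs : 0 < s) :
    HasDerivAt (laplaceMixturePrimitive α c)
      (Real.exp (-s / (2 * α ^ 2)) * Real.exp (-c ^ 2 / (2 * s)) / (α * √s)) s := by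
  obtain ⟨r, hr, rfl⟩ : ∃ r : ℝ, 0 < r ∧ s = r ^ 2 :=
    ⟨√s, Real.sqrt_pos.2 hs, (Real.sq_sqrt hs.le).symm⟩
  have hsqrt : √(r ^ 2) = r := Real.sqrt_sq hr.le
  have hd : HasDerivAt (fun s : ℝ => √s) (1 / (2 * r)) (r ^ 2) := by
    simpa [hsqrt] using Real.hasDerivAt_sqrt hs.ne'
  have hq : HasDerivAt (fun s : ℝ => c / √s) (-(c / r ^ 2) * (1 / (2 * r))) (r ^ 2) := by
    refine ((hasDerivAt_const (r ^ 2) c).fun_div hd (by rw [hsqrt]; exact hr.ne')).congr_deriv ?_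
    rw [hsqrt]
    field_simp
    ring
  have h₁ := ((hasDerivAt_gaussianPrimitive _).comp (r ^ 2)
    ((hd.div_const α).sub hq)).const_mul (Real.exp (-c / α))
  have h₂ := ((hasDerivAt_gaussianPrimitive _).comp (r ^ 2)
    ((hd.div_const α).add hq)).const_mul (Real.exp (c / α))
  have e₁ : Real.exp (-c / α) * Real.exp (-(1 / 2) * (r / α - c / r) ^ 2) =
      Real.exp (-r ^ 2 / (2 * α ^ 2)) * Real.exp (-c ^ 2 / (2 * r ^ 2)) := by
    rw [← Real.exp_add, ← Real.exp_add]
    congr 1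
    field_simp
    ring
  have e₂ : Real.exp (c / α) * Real.exp (-(1 / 2) * (r / α + c / r) ^ 2) =
      Real.exp (-r ^ 2 / (2 * α ^ 2)) * Real.exp (-c ^ 2 / (2 * r ^ 2)) := by
    rw [← Real.exp_add, ← Real.exp_add]
    congr 1
    field_simp
    ring
  refine (h₁.add h₂).congr_deriv ?_
  simp only [Pi.sub_apply, Pi.add_apply, hsqrt]
  rw [← mul_assoc, ← mul_assoc, e₁, e₂]
  field_simp
  ring

lemma tendsto_laplaceMixturePrimitive_atTop {α : ℝ} (hα : 0 < α) (c : ℝ) :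
    Tendsto (laplaceMixturePrimitive α c) atTop
      (𝓝 (Real.exp (-c / α) * (√(2 * π) / 2) + Real.exp (c / α) * (√(2 * π) / 2))) := by
  have hr : Tendsto (fun s : ℝ => √s / α) atTop atTop :=
    Real.tendsto_sqrt_atTop.atTop_div_const hα
  have hq : Tendsto (fun s : ℝ => c / √s) atTop (𝓝 0) :=
    tendsto_const_nhds.div_atTop Real.tendsto_sqrt_atTop
  have hm : Tendsto (fun s : ℝ => √s / α - c / √s) atTop atTop := by
    simpa only [sub_eq_add_neg] using hr.atTop_add hq.neg
  exact ((tendsto_gaussianPrimitive_atTop.comp hm).const_mul _).add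
    ((tendsto_gaussianPrimitive_atTop.comp (hr.atTop_add hq)).const_mul _)

lemma tendsto_laplaceMixturePrimitive_nhdsGT_zero (α : ℝ) {c : ℝ} (hc : 0 ≤ c) :
    Tendsto (laplaceMixturePrimitive α c) (𝓝[>] 0)
      (𝓝 (Real.exp (-c / α) * -(√(2 * π) / 2) + Real.exp (c / α) * (√(2 * π) / 2))) := by
  have hs : Tendsto (fun s : ℝ => √s) (𝓝[>] 0) (𝓝 0) := by
    simpa using (Real.continuous_sqrt.tendsto 0).mono_left nhdsWithin_le_nhds
  have hr : Tendsto (fun s : ℝ => √s / α) (𝓝[>] 0) (𝓝 0) := by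
    simpa using hs.div_const α
  rcases hc.eq_or_lt with rfl | hc
  · have h := ((hasDerivAt_gaussianPrimitive 0).continuousAt.tendsto.comp hr).const_mul 2
    rw [gaussianPrimitive_zero] at h
    convert h using 1
    · ext s
      simp [laplaceMixturePrimitive, two_mul]
    · simp
  · have hs' : Tendsto (fun s : ℝ => √s) (𝓝[>] 0) (𝓝[>] 0) :=
      tendsto_nhdsWithin_iff.2
        ⟨hs, eventually_mem_nhdsWithin.mono fun s hs => Real.sqrt_pos.2 hs⟩
    have hq : Tendsto (fun s : ℝ => c / √s) (𝓝[>] 0) atTop := by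
      simpa only [div_eq_mul_inv, Pi.inv_apply] using
        hs'.inv_tendsto_nhdsGT_zero.const_mul_atTop hc
    have hm : Tendsto (fun s : ℝ => √s / α - c / √s) (𝓝[>] 0) atBot := by
      simpa only [sub_eq_add_neg, Function.comp_apply] using
        hr.add_atBot (tendsto_neg_atTop_atBot.comp hq)
    exact ((tendsto_gaussianPrimitive_atBot.comp hm).const_mul _).add
      ((tendsto_gaussianPrimitive_atTop.comp (hr.add_atTop hq)).const_mul _)

/-- For every `α > 0` and every `x ∈ ℝ`, setting `β = 2α²`, one has
`(1/(2α))·e^{−|x|/α} = ∫₀^∞ (1/β)·e^{−s/β} · e^{−x²/(2s)}/√(2πs) ds`,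
the integral being absolutely convergent. -/
theorem laplace_kernel_as_gaussian_mixture (α : ℝ) (hα : 0 < α) (x : ℝ)
    (β : ℝ) (hβ : β = 2 * α ^ 2) :
    IntegrableOn
      (fun s : ℝ => (1 / β) * Real.exp (-s / β) *
        (Real.exp (-x ^ 2 / (2 * s)) / Real.sqrt (2 * Real.pi * s))) (Ioi 0) ∧
    (1 / (2 * α)) * Real.exp (-|x| / α) =
      ∫ s in Ioi (0 : ℝ), (1 / β) * Real.exp (-s / β) *
        (Real.exp (-x ^ 2 / (2 * s)) / Real.sqrt (2 * Real.pi * s)) := by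
  subst hβ
  have hπ : 0 < √(2 * π) := by positivity
  have hderiv : ∀ s ∈ Ioi (0 : ℝ), HasDerivAt
      (fun s => 1 / (2 * α * √(2 * π)) * laplaceMixturePrimitive α |x| s)
      ((1 / (2 * α ^ 2)) * Real.exp (-s / (2 * α ^ 2)) *
        (Real.exp (-x ^ 2 / (2 * s)) / √(2 * π * s))) s := by
    intro s hs
    have hs0 : 0 < √s := Real.sqrt_pos.2 hs
    refine ((hasDerivAt_laplaceMixturePrimitive hα |x| hs).const_mul
      (1 / (2 * α * √(2 * π)))).congr_deriv ?_
    rw [sq_abs, Real.sqrt_mul (by positivity) s]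
    field_simp
  obtain ⟨hint, heq⟩ := integrableOn_and_integral_Ioi_of_hasDerivAt_of_nonneg_of_tendsto hderiv
    (fun s _ => by positivity)
    ((tendsto_laplaceMixturePrimitive_nhdsGT_zero α (abs_nonneg x)).const_mul _)
    ((tendsto_laplaceMixturePrimitive_atTop hα |x|).const_mul _)
  refine ⟨hint, ?_⟩
  rw [heq]
  field_simp
  ring
end

section
/- Let n ≥ 1, let S be a real diagonal n×n matrix with strictly positive diagonal entries, let K be a real symmetric n×n matrix, and set A = S + iK. Then the entrywise real part Re(A⁻¹) of the inverse of A is an invertible real symmetric matrix, it is positive definite, and (Re(A⁻¹))⁻¹ = S + K·S⁻¹·K. -/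
open Matrix

namespace Matrix

variable {ι : Type*} [Fintype ι] [DecidableEq ι]

/-- For `S` positive definite and `K` symmetric, `S + K S⁻¹ K` is positive definite. -/
lemma PosDef.add_mul_inv_mul {S K : Matrix ι ι ℝ} (hS : S.PosDef) (hK : K.IsSymm) :
    (S + K * S⁻¹ * K).PosDef := by
  refine hS.add_posSemidef ?_
  have h := hS.inv.posSemidef.conjTranspose_mul_mul_same K
  rwa [conjTranspose_eq_transpose_of_trivial, hK.eq] at h

/-- Explicit inverse of `S + iK` in terms of the inverses of `S` and `S + K S⁻¹ K`. -/
lemma inv_map_ofReal_add_I_smul {S K : Matrix ι ι ℝ} (hS : IsUnit S.det)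
    (hM : IsUnit (S + K * S⁻¹ * K).det) :
    (S.map Complex.ofReal + Complex.I • K.map Complex.ofReal)⁻¹ =
      ((S + K * S⁻¹ * K)⁻¹).map Complex.ofReal -
        Complex.I • (S⁻¹ * K * (S + K * S⁻¹ * K)⁻¹).map Complex.ofReal := by
  apply inv_eq_right_inv
  set X := (S + K * S⁻¹ * K)⁻¹ with hX
  have h_re : S * X + K * (S⁻¹ * K * X) = 1 := by
    rw [← mul_nonsing_inv _ hM, ← hX]
    noncomm_ring
  have h_im : S * (S⁻¹ * K * X) = K * X := by
    rw [mul_assoc, mul_nonsing_inv_cancel_left _ _ hS]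
  have map_mul' (P Q : Matrix ι ι ℝ) :
      P.map Complex.ofReal * Q.map Complex.ofReal = (P * Q).map Complex.ofReal :=
    (Matrix.map_mul (f := Complex.ofRealHom)).symm
  have h_one : (S * X).map Complex.ofReal + (K * (S⁻¹ * K * X)).map Complex.ofReal = 1 := by
    rw [← Matrix.map_add _ Complex.ofReal_add, h_re]
    exact Matrix.map_one _ Complex.ofReal_zero Complex.ofReal_one
  rw [add_mul, mul_sub, mul_sub, Matrix.mul_smul, Matrix.smul_mul, Matrix.smul_mul,
    Matrix.mul_smul, smul_smul, Complex.I_mul_I, map_mul', map_mul', map_mul', map_mul', h_im, ← h_one,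
    neg_one_smul]
  abel

/-- The real part of `(S + iK)⁻¹` is `(S + K S⁻¹ K)⁻¹`. -/
lemma map_re_inv_map_ofReal_add_I_smul {S K : Matrix ι ι ℝ} (hS : IsUnit S.det)
    (hM : IsUnit (S + K * S⁻¹ * K).det) :
    ((S.map Complex.ofReal + Complex.I • K.map Complex.ofReal)⁻¹).map Complex.re =
      (S + K * S⁻¹ * K)⁻¹ := by
  rw [inv_map_ofReal_add_I_smul hS hM]
  ext i j
  simp

end Matrix

/-- Let `S` be a real diagonal matrix with positive diagonal entries, `K`
real symmetric, and `A = S + iK`. Then the entrywise real part `Re(A⁻¹)` is an invertible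
real symmetric matrix, it is positive definite, and `(Re(A⁻¹))⁻¹ = S + K·S⁻¹·K`. -/
theorem real_part_inverse_of_S_plus_iK (n : ℕ) (hn : 1 ≤ n)
    (d : Fin n → ℝ) (hd : ∀ i, 0 < d i)
    (K : Matrix (Fin n) (Fin n) ℝ) (hK : K.IsSymm)
    (S : Matrix (Fin n) (Fin n) ℝ) (hS : S = Matrix.diagonal d)
    (A : Matrix (Fin n) (Fin n) ℂ)
    (hA : A = S.map Complex.ofReal + Complex.I • K.map Complex.ofReal)
    (R : Matrix (Fin n) (Fin n) ℝ) (hR : R = (A⁻¹).map Complex.re) :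
    R.IsSymm ∧ IsUnit R ∧ R.PosDef ∧ R⁻¹ = S + K * S⁻¹ * K := by
  have hS_pos : S.PosDef := hS ▸ PosDef.diagonal hd
  have hM := hS_pos.add_mul_inv_mul hK
  have hM_det : IsUnit (S + K * S⁻¹ * K).det := (isUnit_iff_isUnit_det _).mp hM.isUnit
  have hR_eq : R = (S + K * S⁻¹ * K)⁻¹ := by
    rw [hR, hA,
      map_re_inv_map_ofReal_add_I_smul ((isUnit_iff_isUnit_det _).mp hS_pos.isUnit) hM_det]
  have hR_pos : R.PosDef := hR_eq ▸ hM.inv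
  refine ⟨?_, hR_pos.isUnit, hR_pos, ?_⟩
  · rw [IsSymm, ← conjTranspose_eq_transpose_of_trivial]
    exact hR_pos.isHermitian
  · rw [hR_eq, nonsing_inv_nonsing_inv _ hM_det]
end

section
/- For every κ ≥ 0, ∫₀^∞ e^{−s} · (1 + κ²/s²)^{1/4} ds ≤ 1 + (9/4)·κ. -/
open MeasureTheory Real Set

lemma one_add_sq_rpow_quarter_le_one_add_sqrt {x : ℝ} (hx : 0 ≤ x) :
    (1 + x ^ 2) ^ ((1 : ℝ) / 4) ≤ 1 + x ^ ((1 : ℝ) / 2) := by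
  set y := x ^ ((1 : ℝ) / 2) with hy
  have hy0 : 0 ≤ y := by positivity
  have hxy : x = y ^ 2 := by
    rw [hy, ← Real.rpow_natCast, ← Real.rpow_mul hx]
    norm_num
  calc (1 + x ^ 2) ^ ((1 : ℝ) / 4) ≤ ((1 + y) ^ (4 : ℕ)) ^ ((1 : ℝ) / 4) := by
        refine Real.rpow_le_rpow (by positivity) ?_ (by norm_num)
        rw [hxy]
        have h3 : 0 ≤ y ^ 3 := by positivity
        nlinarith [sq_nonneg y]
    _ = 1 + y := by
        rw [← Real.rpow_natCast, ← Real.rpow_mul (by positivity)]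
        norm_num

lemma one_add_sq_rpow_quarter_le_one_add_sq_div (x : ℝ) :
    (1 + x ^ 2) ^ ((1 : ℝ) / 4) ≤ 1 + x ^ 2 / 4 := by
  have h := rpow_one_add_le_one_add_mul_self (s := x ^ 2) (by nlinarith [sq_nonneg x])
    (p := (1 : ℝ) / 4) (by norm_num) (by norm_num)
  linarith

/-- For every `κ ≥ 0`,
`∫₀^∞ e^{−s}·(1 + κ²/s²)^{1/4} ds ≤ 1 + (9/4)·κ`. -/
theorem exp_quartic_root_integral_bound (κ : ℝ) (hκ : 0 ≤ κ) :
    IntegrableOn (fun s : ℝ => Real.exp (-s) * (1 + κ ^ 2 / s ^ 2) ^ ((1 : ℝ) / 4))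
      (Ioi 0) ∧
    ∫ s in Ioi (0 : ℝ), Real.exp (-s) * (1 + κ ^ 2 / s ^ 2) ^ ((1 : ℝ) / 4) ≤
      1 + (9 / 4) * κ := by
  have hexp : IntegrableOn (fun s : ℝ => Real.exp (-s)) (Ioi 0) := integrableOn_exp_neg_Ioi 0
  rcases hκ.eq_or_lt with rfl | hpos
  · simpa [-integral_comp_neg_Ioi, integral_exp_neg_Ioi_zero] using hexp
  let near : ℝ → ℝ := fun s => κ ^ ((1 : ℝ) / 2) * s ^ (-(1 : ℝ) / 2)
  let far : ℝ → ℝ := fun s => κ ^ 2 / 4 * s ^ (-2 : ℝ)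
  have hnear : IntegrableOn near (Ioc 0 κ) :=
    ((intervalIntegrable_iff_integrableOn_Ioc_of_le hκ).1
      (intervalIntegral.intervalIntegrable_rpow' (by norm_num))).const_mul _
  have hfar : IntegrableOn far (Ioi κ) :=
    (integrableOn_Ioi_rpow_of_lt (by norm_num) hpos).const_mul _
  have hnear_val : ∫ s in Ioc 0 κ, near s = 2 * κ := by
    rw [← intervalIntegral.integral_of_le hκ, intervalIntegral.integral_const_mul,
      integral_rpow (Or.inl (by norm_num)), Real.zero_rpow (by norm_num)]
    have h : κ ^ ((1 : ℝ) / 2) * κ ^ ((1 : ℝ) / 2) = κ := by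
      rw [← Real.rpow_add hpos]; norm_num
    rw [show (-(1 : ℝ) / 2 + 1) = 1 / 2 by norm_num]
    linear_combination 2 * h
  have hfar_val : ∫ s in Ioi κ, far s = κ / 4 := by
    rw [integral_const_mul, integral_Ioi_rpow_of_lt (by norm_num) hpos,
      show (-2 + 1 : ℝ) = -1 by norm_num, Real.rpow_neg_one]
    field_simp
  let g : ℝ → ℝ := fun s =>
    Real.exp (-s) + ((Ioc 0 κ).indicator near s + (Ioi κ).indicator far s)
  have hnear' : IntegrableOn ((Ioc 0 κ).indicator near) (Ioi 0) :=
    (hnear.integrable_indicator measurableSet_Ioc).integrableOn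
  have hfar' : IntegrableOn ((Ioi κ).indicator far) (Ioi 0) :=
    (hfar.integrable_indicator measurableSet_Ioi).integrableOn
  have hg : IntegrableOn g (Ioi 0) := hexp.add (hnear'.add hfar')
  have hg_val : ∫ s in Ioi 0, g s = 1 + 9 / 4 * κ := by
    have h₁ : ∫ s in Ioi 0, g s = (∫ s in Ioi 0, Real.exp (-s)) +
        ∫ s in Ioi 0, ((Ioc 0 κ).indicator near s + (Ioi κ).indicator far s) :=
      integral_add hexp (hnear'.add hfar')
    rw [h₁, integral_add hnear' hfar', setIntegral_indicator measurableSet_Ioc,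
      setIntegral_indicator measurableSet_Ioi, inter_eq_self_of_subset_right Ioc_subset_Ioi_self,
      inter_eq_self_of_subset_right (Ioi_subset_Ioi hκ), hnear_val, hfar_val,
      integral_exp_neg_Ioi_zero]
    ring
  have hle : ∀ s ∈ Ioi (0 : ℝ),
      Real.exp (-s) * (1 + κ ^ 2 / s ^ 2) ^ ((1 : ℝ) / 4) ≤ g s := by
    intro s (hs : 0 < s)
    have hexp_le : Real.exp (-s) ≤ 1 := Real.exp_le_one_iff.2 (by linarith)
    suffices h : ∃ r, 0 ≤ r ∧ (1 + κ ^ 2 / s ^ 2) ^ ((1 : ℝ) / 4) ≤ 1 + r ∧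
        g s = Real.exp (-s) + r by
      obtain ⟨r, hr, hle, hgs⟩ := h
      rw [hgs]
      nlinarith [mul_le_mul_of_nonneg_left hle (Real.exp_pos (-s)).le,
        mul_le_mul_of_nonneg_right hexp_le hr]
    rw [← div_pow]
    rcases le_or_gt s κ with hsκ | hsκ
    · refine ⟨near s, by positivity, ?_, by simp [g, hs, hsκ]⟩
      convert one_add_sq_rpow_quarter_le_one_add_sqrt (x := κ / s) (by positivity) using 2
      rw [Real.div_rpow hκ hs.le, div_eq_mul_inv, ← Real.rpow_neg hs.le]
      norm_num [near]
    · refine ⟨far s, by positivity, ?_, by simp [g, hsκ]⟩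
      convert one_add_sq_rpow_quarter_le_one_add_sq_div (κ / s) using 2
      simp only [far]
      rw [Real.rpow_neg hs.le, Real.rpow_two]
      ring
  have hint : IntegrableOn
      (fun s : ℝ => Real.exp (-s) * (1 + κ ^ 2 / s ^ 2) ^ ((1 : ℝ) / 4)) (Ioi 0) := by
    refine Integrable.mono' hg (by fun_prop) ?_
    refine (ae_restrict_iff' measurableSet_Ioi).2 (.of_forall fun s hs => ?_)
    rw [Real.norm_of_nonneg (by positivity)]
    exact hle s hs
  exact ⟨hint, (setIntegral_mono_on hint hg measurableSet_Ioi hle).trans hg_val.le⟩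
end

section
/- Let γ > 0, let (β_i)_{i≥1} be strictly positive reals, and let (K_{ij})_{i,j≥1} be real numbers such that Σ_{i=1}^{∞} √( Σ_{j=1}^{∞} K_{ij}² / (β_i j^γ) ) < ∞. Let ν be the infinite product, over i ≥ 1, of the exponential probability distributions on (0,∞) with densities s ↦ (1/β_i) e^{−s/β_i}. Then for ν-almost every sequence s = (s_i)_{i≥1}, Σ_{i=1}^{∞} (1/s_i) · Σ_{j=1}^{∞} K_{ij}² / j^γ < ∞. -/
open MeasureTheory

/-- The exponential distribution on `(0,∞)` with mean `β`, as a measure on `ℝ`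
with density `s ↦ (1/β)·e^{−s/β}` on `(0,∞)`. -/
noncomputable def expDist (β : ℝ) : Measure ℝ :=
  MeasureTheory.volume.withDensity fun s =>
    ENNReal.ofReal (if 0 < s then β⁻¹ * Real.exp (-s / β) else 0)

/-- `expDist β` is the exponential distribution with rate `β⁻¹`. -/
theorem expDist_eq_expMeasure (β : ℝ) :
    expDist β = ProbabilityTheory.expMeasure β⁻¹ := by
  unfold expDist ProbabilityTheory.expMeasure ProbabilityTheory.gammaMeasure
  refine withDensity_congr_ae ?_
  have h0 : ∀ᵐ s : ℝ ∂volume, s ≠ 0 := by simp [ae_iff]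
  filter_upwards [h0] with s hs
  have h := ProbabilityTheory.exponentialPDF_eq β⁻¹ s
  rw [ProbabilityTheory.exponentialPDF, ProbabilityTheory.exponentialPDFReal] at h
  rw [ProbabilityTheory.gammaPDF, h]
  rcases hs.lt_or_gt with hs | hs
  · simp [hs.not_gt, hs.not_ge]
  · simp only [hs, hs.le, if_true]
    congr 4
    ring

theorem isProbabilityMeasure_expDist {β : ℝ} (hβ : 0 < β) :
    IsProbabilityMeasure (expDist β) := by
  rw [expDist_eq_expMeasure]
  exact ProbabilityTheory.isProbabilityMeasure_expMeasure (inv_pos.2 hβ)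

theorem expDist_Iio_le {β : ℝ} (hβ : 0 < β) (u : ℝ) :
    expDist β (Set.Iio (β * u)) ≤ ENNReal.ofReal u := by
  rw [expDist, withDensity_apply _ measurableSet_Iio]
  calc ∫⁻ s in Set.Iio (β * u),
        ENNReal.ofReal (if 0 < s then β⁻¹ * Real.exp (-s / β) else 0)
      ≤ ∫⁻ s in Set.Iio (β * u), (Set.Ioi 0).indicator (fun _ => ENNReal.ofReal β⁻¹) s := by
        refine lintegral_mono fun s => ?_
        by_cases hs : 0 < s
        · simp only [hs, if_true, Set.mem_Ioi, Set.indicator_of_mem]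
          refine ENNReal.ofReal_le_ofReal (mul_le_of_le_one_right (inv_nonneg.2 hβ.le) ?_)
          rw [Real.exp_le_one_iff, neg_div]
          exact neg_nonpos.2 (by positivity)
        · simp [hs]
    _ = ENNReal.ofReal u := by
        rw [lintegral_indicator_const measurableSet_Ioi,
          Measure.restrict_apply measurableSet_Ioi, Set.Ioi_inter_Iio, Real.volume_Ioo,
          ← ENNReal.ofReal_mul (inv_nonneg.2 hβ.le), sub_zero, inv_mul_cancel_left₀ hβ.ne']

/-- The one-dimensional marginals of a measure with product finite-dimensional marginals. -/
theorem map_eval_of_map_fin_eq_pi {X : Type*} [MeasurableSpace X] {ν : Measure (ℕ → X)}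
    {μ : ℕ → Measure X} [∀ i, IsProbabilityMeasure (μ i)]
    (hν : ∀ n : ℕ, ν.map (fun x (i : Fin n) => x (i : ℕ)) =
      Measure.pi fun i : Fin n => μ (i : ℕ)) (i : ℕ) :
    ν.map (fun x => x i) = μ i := by
  have h := (measurePreserving_eval (fun j : Fin (i + 1) => μ (j : ℕ)) (Fin.last i)).map_eq
  rw [← hν (i + 1), Measure.map_map (by fun_prop) (by fun_prop)] at h
  simpa [Function.comp_def] using h

theorem inv_mul_le_sqrt {a b s : ℝ} (ha : 0 ≤ a) (hb : 0 < b) (hs : b * √a ≤ s) :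
    ‖s⁻¹ * (b * a)‖ ≤ √a := by
  rcases ha.eq_or_lt with rfl | ha
  · simp
  have hpos : 0 < s := lt_of_lt_of_le (by positivity) hs
  rw [Real.norm_of_nonneg (by positivity), inv_mul_le_iff₀ hpos]
  calc b * a = b * √a * √a := by rw [mul_assoc, Real.mul_self_sqrt ha.le]
    _ ≤ s * √a := by gcongr

/-- Let `γ > 0`, `(β_i)` positive reals and `(K_{ij})` real numbers with
`Σ_i √(Σ_j K_{ij}²/(β_i j^γ)) < ∞` (index `i : ℕ` standing for `i+1 ≥ 1`), and `ν` the
infinite product over `i` of the exponential distributions with means `β_i` (characterized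
by its finite-dimensional marginals). Then for `ν`-almost every sequence `s`,
`Σ_i (1/s_i)·Σ_j K_{ij}²/j^γ < ∞`. -/
theorem SinvK_ae_hilbert_schmidt (γ : ℝ) (hγ : 0 < γ)
    (β : ℕ → ℝ) (hβ : ∀ i, 0 < β i) (K : ℕ → ℕ → ℝ)
    (hKinner : ∀ i : ℕ, Summable (fun j : ℕ => K i j ^ 2 / (β i * ((j : ℝ) + 1) ^ γ)))
    (hKsum : Summable (fun i : ℕ =>
      Real.sqrt (∑' j : ℕ, K i j ^ 2 / (β i * ((j : ℝ) + 1) ^ γ))))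
    (ν : Measure (ℕ → ℝ)) [IsProbabilityMeasure ν]
    (hν : ∀ n : ℕ, ν.map (fun x (i : Fin n) => x (i : ℕ)) =
      Measure.pi fun i : Fin n => expDist (β (i : ℕ))) :
    ∀ᵐ s ∂ν, Summable (fun i : ℕ =>
      (s i)⁻¹ * ∑' j : ℕ, K i j ^ 2 / ((j : ℝ) + 1) ^ γ) := by
  have := fun i => isProbabilityMeasure_expDist (hβ i)
  set a : ℕ → ℝ := fun i => ∑' j : ℕ, K i j ^ 2 / (β i * ((j : ℝ) + 1) ^ γ) with ha
  have ha0 (i : ℕ) : 0 ≤ a i := tsum_nonneg fun j => by have := hβ i; positivity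
  have hba (i : ℕ) : ∑' j : ℕ, K i j ^ 2 / ((j : ℝ) + 1) ^ γ = β i * a i := by
    rw [ha, ← tsum_mul_left]
    refine tsum_congr fun j => ?_
    rw [← mul_div_assoc, mul_div_mul_left _ _ (hβ i).ne']
  have hsmall (i : ℕ) : ν {x | x i < β i * √(a i)} ≤ ENNReal.ofReal √(a i) := by
    refine le_trans (le_of_eq ?_) (expDist_Iio_le (hβ i) _)
    rw [← map_eval_of_map_fin_eq_pi (μ := fun i => expDist (β i)) hν i, Measure.map_apply (by fun_prop) measurableSet_Iio]
    rfl
  have hfin : ∑' i, ν {x | x i < β i * √(a i)} ≠ ⊤ :=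
    ne_top_of_le_ne_top hKsum.tsum_ofReal_ne_top (ENNReal.tsum_le_tsum hsmall)
  filter_upwards [ae_eventually_notMem hfin] with s hs
  refine Summable.of_norm_bounded_eventually_nat hKsum ?_
  filter_upwards [hs] with i hi
  rw [hba]
  exact inv_mul_le_sqrt (ha0 i) (hβ i) (not_lt.1 hi)
end
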